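/- Let Ω ⊂ ℝ³ be a bounded domain with ∂Ω ∈ C^{1,α}, 0 < α ≤ 1, and let C_α > 0 be a uniform Hölder constant for the first derivatives of the local C^{1,α} graph representations of ∂Ω. Then Ω satisfies a uniform interior oblate spheroid condition: there exists δ > 0 such that for every P₀ ∈ ∂Ω the set K_δ(P₀) = { P ∈ ℝ³ : ⟨P − P₀, −n_{P₀}⟩ ≥ 4 C_α |P − P₀|^{1+α} and |P − P₀| ≤ δ } satisfies K_δ(P₀) ∩ (ℝ³ ∖ Ω) = {P₀}. -/

import Mathlib

open Real MeasureTheory Filter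
open scoped RealInnerProductSpace Topology ENNReal NNReal

noncomputable section

abbrev E3 : Type := EuclideanSpace ℝ (Fin 3)

/-- A bounded domain `Ω ⊆ ℝ³` whose boundary `∂Ω` is of class `C^{1,α}`:
`Ω` is open, bounded and connected; near each boundary point the boundary is the graph of a
`C^{1,α}` function of two of the three coordinates, with `Ω` lying strictly on one side of
the graph; `ν` is the outward unit normal field on `∂Ω`. -/
structure C1Domain (α : ℝ) : Type where
  Ω : Set E3
  ν : E3 → E3
  isOpen : IsOpen Ω
  bounded : Bornology.IsBounded Ω
  connected : IsConnected Ω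
  unit_normal : ∀ P ∈ frontier Ω, ‖ν P‖ = 1
  outward : ∀ P ∈ frontier Ω, ∃ ε > 0, ∀ s : ℝ, 0 < s → s < ε →
      P + s • ν P ∉ closure Ω ∧ P - s • ν P ∈ Ω
  graph : ∀ P ∈ frontier Ω, ∃ U : Set E3, IsOpen U ∧ P ∈ U ∧
      ∃ (σ : Equiv.Perm (Fin 3)) (f : ℝ × ℝ → ℝ) (e C : ℝ),
        (e = 1 ∨ e = -1) ∧ ContDiff ℝ 1 f ∧ 0 ≤ C ∧
        (∀ p q : ℝ × ℝ, ‖fderiv ℝ f p - fderiv ℝ f q‖ ≤ C * ‖p - q‖ ^ α) ∧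
        ∀ q ∈ U,
          (q ∈ frontier Ω ↔ q (σ 2) = f (q (σ 0), q (σ 1))) ∧
          (q ∈ Ω ↔ e * (q (σ 2) - f (q (σ 0), q (σ 1))) < 0) ∧
          (q ∉ closure Ω ↔ 0 < e * (q (σ 2) - f (q (σ 0), q (σ 1))))

/-- The sublevel region `{x | c ‖x‖ ^ p ≤ ⟪x, w⟫}` is convex for `0 ≤ c` and `1 ≤ p`. -/
theorem convex_setOf_mul_norm_rpow_le_inner {E : Type*} [NormedAddCommGroup E]
    [InnerProductSpace ℝ E] {c p : ℝ} (hc : 0 ≤ c) (hp : 1 ≤ p) (w : E) :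
    Convex ℝ {x : E | c * ‖x‖ ^ p ≤ ⟪x, w⟫} := by
  intro x hx y hy a b ha hb hab
  simp only [Set.mem_ofPred_eq] at hx hy ⊢
  have hnorm : ‖a • x + b • y‖ ≤ a * ‖x‖ + b * ‖y‖ := by
    simpa [norm_smul, abs_of_nonneg ha, abs_of_nonneg hb] using norm_add_le (a • x) (b • y)
  have hpow : (a * ‖x‖ + b * ‖y‖) ^ p ≤ a * ‖x‖ ^ p + b * ‖y‖ ^ p := by
    simpa using (convexOn_rpow hp).2 (norm_nonneg x) (norm_nonneg y) ha hb hab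
  calc c * ‖a • x + b • y‖ ^ p
      ≤ c * (a * ‖x‖ ^ p + b * ‖y‖ ^ p) := by
        gcongr
        exact (rpow_le_rpow (norm_nonneg _) hnorm (by linarith)).trans hpow
    _ = a * (c * ‖x‖ ^ p) + b * (c * ‖y‖ ^ p) := by ring
    _ ≤ a * ⟪x, w⟫ + b * ⟪y, w⟫ := by gcongr
    _ = ⟪a • x + b • y, w⟫ := by
        rw [inner_add_left, real_inner_smul_left, real_inner_smul_left]

/-- **Uniform interior oblate spheroid condition.** Let `Ω ⊆ ℝ³` be a bounded domain with
`∂Ω ∈ C^{1,α}`, `0 < α ≤ 1`, and let `C_α > 0` be a uniform constant such that for every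
`P₀ ∈ ∂Ω` and every `P ∈ ∂Ω` within a fixed distance `ρ > 0` of `P₀` one has
`|⟨P - P₀, n_{P₀}⟩| ≤ 2 C_α |P - P₀| ^ (1+α)`.  Then there is `δ > 0` such that for every
`P₀ ∈ ∂Ω` the oblate spheroid
`K_δ(P₀) = {P : ⟨P - P₀, -n_{P₀}⟩ ≥ 4 C_α |P - P₀|^(1+α), |P - P₀| ≤ δ}` meets
`ℝ³ ∖ Ω` only in `P₀`. -/
theorem uniform_interior_oblate_spheroid
    (α : ℝ) (hα0 : 0 < α) (hα1 : α ≤ 1) (D : C1Domain α)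
    (Cα ρ : ℝ) (hCα : 0 < Cα) (hρ : 0 < ρ)
    (hflat : ∀ P₀ ∈ frontier D.Ω, ∀ P ∈ frontier D.Ω, ‖P - P₀‖ < ρ →
      |⟪P - P₀, D.ν P₀⟫| ≤ 2 * Cα * ‖P - P₀‖ ^ (1 + α)) :
    ∃ δ > (0 : ℝ), ∀ P₀ ∈ frontier D.Ω,
      {P : E3 | 4 * Cα * ‖P - P₀‖ ^ (1 + α) ≤ ⟪P - P₀, -D.ν P₀⟫ ∧ ‖P - P₀‖ ≤ δ} ∩ D.Ωᶜ
        = {P₀} := by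
  refine ⟨ρ / 2, half_pos hρ, fun P₀ hP₀ => ?_⟩
  have hP₀Ω : P₀ ∉ D.Ω := fun h => (D.isOpen.inter_frontier_eq.subset ⟨h, hP₀⟩).elim
  refine Set.Subset.antisymm ?_ ?_
  swap
  · rintro _ rfl
    refine ⟨⟨?_, ?_⟩, hP₀Ω⟩
    · simp [zero_rpow (by linarith : 1 + α ≠ 0)]
    · simpa using (half_pos hρ).le
  rintro P ⟨⟨hPK, hPδ⟩, hPΩ⟩
  by_contra hne
  refine hPΩ ?_
  set w : E3 := -D.ν P₀ with hw
  have hw1 : ‖w‖ = 1 := by rw [hw, norm_neg, D.unit_normal P₀ hP₀]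
  -- A point `P₀ + x` with `x` in `S` lies off the boundary and within `ρ` of `P₀`.
  let S : Set E3 := {x | 4 * Cα * ‖x‖ ^ (1 + α) ≤ ⟪x, w⟫} ∩ {x | 0 < ⟪x, w⟫} ∩
    Metric.ball 0 ρ
  have hSconv : Convex ℝ S := by
    refine ((convex_setOf_mul_norm_rpow_le_inner (by positivity) (by linarith) w).inter ?_).inter
      (convex_ball _ _)
    exact convex_halfSpace_gt
      ⟨fun x y => inner_add_left x y w, fun a x => by simp [real_inner_smul_left]⟩ 0
  have hSfr : ∀ x ∈ S, P₀ + x ∉ frontier D.Ω := by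
    rintro x ⟨⟨hxK, hx0⟩, hxρ⟩ hfr
    have hflat' := hflat P₀ hP₀ _ hfr (by simpa using hxρ)
    simp only [Set.mem_ofPred_eq] at hxK hx0
    rw [add_sub_cancel_left] at hflat'
    have hinner : ⟪x, D.ν P₀⟫ = -⟪x, w⟫ := by rw [hw, inner_neg_right, neg_neg]
    rw [hinner, abs_neg, abs_of_pos hx0] at hflat'
    linarith
  have hPS : P - P₀ ∈ S := by
    have hpos : 0 < ‖P - P₀‖ := norm_pos_iff.2 (sub_ne_zero.2 hne)
    refine ⟨⟨hPK, lt_of_lt_of_le ?_ hPK⟩, ?_⟩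
    · positivity
    · rw [mem_ball_zero_iff]; linarith
  obtain ⟨ε, hε, hout⟩ := D.outward P₀ hP₀
  have hlim : Tendsto (fun s : ℝ => 4 * Cα * s ^ α) (𝓝[>] 0) (𝓝 0) := by
    have h := ((continuousAt_rpow_const 0 α (Or.inr hα0.le)).tendsto.const_mul (4 * Cα))
    rw [zero_rpow hα0.ne', mul_zero] at h
    exact h.mono_left nhdsWithin_le_nhds
  obtain ⟨s, hs1, hs0, hsε, hsρ⟩ : ∃ s : ℝ, 4 * Cα * s ^ α < 1 ∧ 0 < s ∧ s < ε ∧ s < ρ :=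
    ((hlim.eventually_lt_const one_pos).and
      ((eventually_mem_nhdsWithin).and
        ((eventually_nhdsWithin_of_eventually_nhds (eventually_lt_nhds hε)).and
          (eventually_nhdsWithin_of_eventually_nhds (eventually_lt_nhds hρ))))).exists
  have hnorm : ‖s • w‖ = s := by rw [norm_smul, hw1, norm_of_nonneg hs0.le, mul_one]
  have hinner : ⟪s • w, w⟫ = s := by
    rw [real_inner_smul_left, real_inner_self_eq_norm_sq, hw1]; ring
  have hsS : s • w ∈ S := by
    refine ⟨⟨?_, ?_⟩, ?_⟩
    · simp only [Set.mem_ofPred_eq]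
      rw [hnorm, hinner, rpow_add hs0, rpow_one]
      nlinarith
    · simpa only [Set.mem_ofPred_eq, hinner] using hs0
    · rwa [mem_ball_zero_iff, hnorm]
  have hconn : IsPreconnected ((P₀ + ·) '' S) :=
    hSconv.isPreconnected.image _ (by fun_prop)
  have hsub : (P₀ + ·) '' S ⊆ D.Ω := by
    refine hconn.subset_left_of_subset_union D.isOpen isClosed_closure.isOpen_compl
      (disjoint_compl_right.mono_left subset_closure) ?_
      ⟨P₀ + s • w, ⟨s • w, hsS, rfl⟩, by
        simpa [hw, sub_eq_add_neg] using (hout s hs0 hsε).2⟩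
    rintro _ ⟨x, hx, rfl⟩
    by_contra hnot
    rw [Set.mem_union, not_or, Set.notMem_compl_iff] at hnot
    exact hSfr x hx (D.isOpen.frontier_eq ▸ ⟨hnot.2, hnot.1⟩)
  exact hsub ⟨P - P₀, hPS, add_sub_cancel P₀ P⟩
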